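/- Let G be the group presented on generators a, b, c, d with relators a², b², c², d², (ab)⁵, (bc)³, (cd)⁵, (ac)², (ad)², (bd)², (abc)⁵ and (bcd)⁵. Then G is isomorphic to the projective special linear group PSL(2, ZMod 19), G has order 3420, and the subgroup of G generated by {a, b, c} has index 57. -/

import Mathlib

namespace Stmt13

/-- The generators `a`, `b`, `c`, `d` of the free group on four letters. -/
def a : FreeGroup (Fin 4) := FreeGroup.of 0
def b : FreeGroup (Fin 4) := FreeGroup.of 1
def c : FreeGroup (Fin 4) := FreeGroup.of 2
def d : FreeGroup (Fin 4) := FreeGroup.of 3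

/-- Relators for the Coxeter group `[5,3,5]` together with the Petrie relators `(abc)⁵` and `(bcd)⁵`. -/
def rels : Set (FreeGroup (Fin 4)) :=
  {a ^ 2, b ^ 2, c ^ 2, d ^ 2, (a * b) ^ 5, (b * c) ^ 3, (c * d) ^ 5,
    (a * c) ^ 2, (a * d) ^ 2, (b * d) ^ 2, (a * b * c) ^ 5, (b * c * d) ^ 5}

/-- The group presented by the above relators. -/
abbrev G := PresentedGroup rels

/-- The images of the generators in `G`. -/
def ga : G := PresentedGroup.of 0
def gb : G := PresentedGroup.of 1
def gc : G := PresentedGroup.of 2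
def gd : G := PresentedGroup.of 3

/-! ### A checker for coset enumerations

Let `g : ι → Γ` be a family of involutions in a group acting on a set with base point `x₀`. A word
`u` over `ι` names the point `wordProd g u • x₀`. -/

section CosetEnumeration

variable {ι Γ X : Type*} [Group Γ] [MulAction Γ X]

/-- The value of a word in a family of group elements. -/
def wordProd (g : ι → Γ) (w : List ι) : Γ := (w.map g).prod

@[simp]
theorem wordProd_nil (g : ι → Γ) : wordProd g [] = 1 := rfl

@[simp]
theorem wordProd_cons (g : ι → Γ) (x : ι) (w : List ι) :
    wordProd g (x :: w) = g x * wordProd g w := by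
  simp [wordProd]

/-- A partial coset table: the entry `((x, u), v)` records that the generator `x` sends the point
named by the word `u` to the point named by the word `v`. -/
abbrev CosetTable (ι : Type*) := List ((ι × List ι) × List ι)

namespace CosetTable

/-- Every entry of the table holds in the given action. -/
def Sound (g : ι → Γ) (x₀ : X) (E : CosetTable ι) : Prop :=
  ∀ e ∈ E, g e.1.1 • wordProd g e.1.2 • x₀ = wordProd g e.2 • x₀

/-- Record that the involution `x` exchanges the points named by `u` and `v`. -/
def addEdge (x : ι) (u v : List ι) (E : CosetTable ι) : CosetTable ι :=
  ((x, u), v) :: ((x, v), u) :: E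

/-- The table of the generators in `A` fixing the base point, together with the
edges `u ↦ x :: u` between words of `reps`. -/
def initial (A : List ι) (reps : List (List ι)) : CosetTable ι :=
  A.map (fun x => ((x, []), [])) ++ reps.flatMap fun
    | [] => []
    | x :: u => addEdge x u (x :: u) []

/-- The image of a point under a word, when the table determines it. -/
def trace [DecidableEq ι] (E : CosetTable ι) (w : List ι) (u : List ι) : Option (List ι) :=
  w.foldr (fun x o => o.bind fun v => E.lookup (x, v)) (some u)

/-- Scan the relator `r` at the point `u`, and record the value this forces for its first letter. -/
def deduce [DecidableEq ι] (r : List ι) (u : List ι) (E : CosetTable ι) : CosetTable ι :=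
  match r with
  | [] => E
  | x :: w => ((E.trace w u).map fun v => addEdge x v u E).getD E

/-- Carry out a list of deductions `(m, k, i)`: scan the `m`-th relator, rotated by `k`, at the
`i`-th point. -/
def run [DecidableEq ι] (rels reps : List (List ι)) (steps : List (ℕ × ℕ × ℕ))
    (E : CosetTable ι) : CosetTable ι :=
  steps.foldl (fun E s => deduce ((rels.getD s.1 []).rotate s.2.1) (reps.getD s.2.2 []) E) E

/-- The points of `reps` include the base point and are closed under the generators in `B`. -/
def Closed [DecidableEq ι] (B : List ι) (reps : List (List ι)) (E : CosetTable ι) : Prop :=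
  [] ∈ reps ∧ ∀ u ∈ reps, ∀ x ∈ B, ∃ v ∈ E.lookup (x, u), v ∈ reps

instance [DecidableEq ι] (B : List ι) (reps : List (List ι)) (E : CosetTable ι) :
    Decidable (E.Closed B reps) :=
  inferInstanceAs (Decidable (_ ∧ _))

variable {g : ι → Γ} {x₀ : X} {E : CosetTable ι}

theorem Sound.addEdge (hE : E.Sound g x₀) (hg : ∀ x, g x * g x = 1) {x : ι} {u v : List ι}
    (h : g x • wordProd g u • x₀ = wordProd g v • x₀) : (E.addEdge x u v).Sound g x₀ := by
  intro e he
  simp only [CosetTable.addEdge, List.mem_cons] at he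
  rcases he with rfl | rfl | he
  · exact h
  · simp only [← h, smul_smul, ← mul_assoc, hg, one_mul]
  · exact hE e he

theorem sound_initial (hg : ∀ x, g x * g x = 1) {A : List ι} (hA : ∀ x ∈ A, g x • x₀ = x₀)
    (reps : List (List ι)) : (initial A reps).Sound g x₀ := by
  intro e he
  simp only [initial, List.mem_append, List.mem_map, List.mem_flatMap] at he
  obtain ⟨x, hx, rfl⟩ | ⟨_ | ⟨x, u⟩, -, he⟩ := he
  · simpa using hA x hx
  · simp at he
  · have hnil : Sound g x₀ ([] : CosetTable ι) := by simp [Sound]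
    exact hnil.addEdge hg (by simp [mul_smul]) e he

variable [DecidableEq ι]

theorem Sound.lookup (hE : E.Sound g x₀) {x : ι} {u v : List ι} (h : E.lookup (x, u) = some v) :
    g x • wordProd g u • x₀ = wordProd g v • x₀ := by
  obtain ⟨l₁, l₂, rfl, -⟩ := List.lookup_eq_some_iff.1 h
  exact hE ((x, u), v) (by simp)

theorem Sound.trace (hE : E.Sound g x₀) {w u v : List ι} (h : E.trace w u = some v) :
    wordProd g w • wordProd g u • x₀ = wordProd g v • x₀ := by
  induction w generalizing v with
  | nil =>
    obtain rfl : u = v := by simpa [CosetTable.trace] using h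
    simp
  | cons x w ih =>
    obtain ⟨y, hy, hv⟩ := Option.bind_eq_some_iff.1 h
    rw [wordProd_cons, mul_smul, ih hy, hE.lookup hv]

theorem Sound.deduce (hE : E.Sound g x₀) (hg : ∀ x, g x * g x = 1) {r : List ι}
    (hr : wordProd g r = 1) (u : List ι) : (E.deduce r u).Sound g x₀ := by
  match r with
  | [] => exact hE
  | x :: w =>
    rw [CosetTable.deduce]
    cases h : E.trace w u with
    | none => exact hE
    | some v =>
      refine hE.addEdge hg ?_
      rw [← hE.trace h, smul_smul, ← wordProd_cons, hr, one_smul]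

theorem Sound.run (hE : E.Sound g x₀) (hg : ∀ x, g x * g x = 1) {rels : List (List ι)}
    (hr : ∀ r ∈ rels, wordProd g r = 1) (reps : List (List ι)) (steps : List (ℕ × ℕ × ℕ)) :
    (E.run rels reps steps).Sound g x₀ := by
  induction steps generalizing E with
  | nil => exact hE
  | cons s steps ih =>
    refine ih (hE.deduce hg ?_ _)
    have h : wordProd g (rels.getD s.1 []) = 1 := by
      rw [List.getD_eq_getElem?_getD]
      cases h : rels[s.1]? with
      | none => rfl
      | some r => exact hr r (List.mem_of_getElem? h)
    rw [wordProd, List.map_rotate]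
    exact List.prod_rotate_eq_one_of_prod_eq_one h _

end CosetTable

open CosetTable Pointwise

/-- A successful coset enumeration bounds the index of the subgroup generated by some of the
involutions in the subgroup generated by others. -/
theorem relIndex_closure_le_of_closed [DecidableEq ι] {g : ι → Γ} (hg : ∀ x, g x * g x = 1)
    {rels : List (List ι)} (hr : ∀ r ∈ rels, wordProd g r = 1) {A B : List ι}
    {reps : List (List ι)} {steps : List (ℕ × ℕ × ℕ)}
    (h : ((initial A reps).run rels reps steps).Closed B reps) :
    (Subgroup.closure (g '' {x | x ∈ A})).relIndex (Subgroup.closure (g '' {x | x ∈ B}))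
      ∈ Set.Icc 1 reps.length := by
  classical
  set H := Subgroup.closure (g '' {x | x ∈ A})
  set K := Subgroup.closure (g '' {x | x ∈ B})
  let x₀ : Γ ⧸ H := ((1 : Γ) : Γ ⧸ H)
  have hA : ∀ x ∈ A, g x • x₀ = x₀ := fun x hx => by
    have : g x ∈ MulAction.stabilizer Γ x₀ := by
      rw [MulAction.stabilizer_quotient]
      exact Subgroup.subset_closure ⟨x, hx, rfl⟩
    exact this
  have hE := (sound_initial hg hA reps).run hg hr reps steps
  let P : Finset (Γ ⧸ H) := (reps.map fun u => wordProd g u • x₀).toFinset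
  have hK : K ≤ MulAction.stabilizer Γ P := by
    rw [Subgroup.closure_le]
    rintro _ ⟨x, hx, rfl⟩
    rw [SetLike.mem_coe, MulAction.mem_stabilizer_finset']
    intro q hq
    simp only [P, List.mem_toFinset, List.mem_map] at hq ⊢
    obtain ⟨u, hu, rfl⟩ := hq
    obtain ⟨v, hv, hv'⟩ := h.2 u hu x hx
    exact ⟨v, hv', (hE.lookup hv).symm⟩
  have horb : MulAction.orbit K x₀ ⊆ P := by
    rintro _ ⟨k, rfl⟩
    change (k : Γ) • x₀ ∈ P
    refine MulAction.mem_stabilizer_finset'.1 (hK k.2) ?_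
    simp only [P, List.mem_toFinset, List.mem_map]
    exact ⟨[], h.1, by simp⟩
  have hstab : H.subgroupOf K = MulAction.stabilizer K x₀ := by
    ext k
    exact (SetLike.ext_iff.1 (MulAction.stabilizer_quotient H) (k : Γ)).symm
  rw [Subgroup.relIndex, hstab, MulAction.index_stabilizer]
  refine ⟨(Set.ncard_pos (P.finite_toSet.subset horb)).2 (MulAction.nonempty_orbit _), ?_⟩
  calc (MulAction.orbit K x₀).ncard ≤ (P : Set (Γ ⧸ H)).ncard := Set.ncard_le_ncard horb
    _ ≤ reps.length := by
      rw [Set.ncard_coe_finset]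
      exact (List.toFinset_card_le _).trans_eq (by simp)

end CosetEnumeration

/-! ### The order of `G` is at most 3420 -/

/-- The relators of `G` other than the squares of the generators, as words. -/
def relatorWords : List (List (Fin 4)) :=
  [(List.replicate 5 [0, 1]).flatten, (List.replicate 3 [1, 2]).flatten,
    (List.replicate 5 [2, 3]).flatten, (List.replicate 2 [0, 2]).flatten,
    (List.replicate 2 [0, 3]).flatten, (List.replicate 2 [1, 3]).flatten,
    (List.replicate 5 [0, 1, 2]).flatten, (List.replicate 5 [1, 2, 3]).flatten]

theorem of_mul_self (x : Fin 4) : (PresentedGroup.of x : G) * PresentedGroup.of x = 1 := by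
  have h : (PresentedGroup.mk rels (FreeGroup.of x ^ 2)) = 1 :=
    PresentedGroup.one_of_mem (by fin_cases x <;> simp [rels, a, b, c, d])
  rwa [pow_two, map_mul] at h

theorem wordProd_relatorWords :
    ∀ r ∈ relatorWords, wordProd (PresentedGroup.of : Fin 4 → G) r = 1 := by
  intro r hr
  have key : ∀ w : List (Fin 4), wordProd (PresentedGroup.of : Fin 4 → G) w =
      PresentedGroup.mk rels (wordProd FreeGroup.of w) := fun w => by
    rw [wordProd, wordProd, map_list_prod, List.map_map]; rfl
  rw [key]
  apply PresentedGroup.one_of_mem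
  simp only [relatorWords, List.mem_cons, List.not_mem_nil, or_false] at hr
  rcases hr with rfl | rfl | rfl | rfl | rfl | rfl | rfl | rfl <;>
    simp [rels, a, b, c, d, wordProd, List.replicate, pow_succ, mul_assoc]

/-- Words for representatives of the 57 cosets of `⟨a, b, c⟩` in `G`. -/
def facetReps : List (List (Fin 4)) :=
  [[], [3], [2, 3], [1, 2, 3], [3, 2, 3], [0, 1, 2, 3], [3, 1, 2, 3], [2, 3, 2, 3], [1, 0, 1,
    2, 3], [3, 0, 1, 2, 3], [2, 3, 1, 2, 3], [1, 2, 3, 2, 3], [0, 1, 0, 1, 2, 3], [3, 1, 0, 1,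
    2, 3], [2, 3, 0, 1, 2, 3], [1, 2, 3, 1, 2, 3], [0, 1, 2, 3, 2, 3], [3, 0, 1, 0, 1, 2, 3],
    [2, 3, 1, 0, 1, 2, 3], [1, 2, 3, 0, 1, 2, 3], [3, 2, 3, 0, 1, 2, 3], [1, 0, 1, 2, 3, 2, 3],
    [2, 3, 0, 1, 0, 1, 2, 3], [1, 2, 3, 1, 0, 1, 2, 3], [3, 2, 3, 1, 0, 1, 2, 3], [0, 1, 2, 3,
    0, 1, 2, 3], [3, 1, 2, 3, 0, 1, 2, 3], [0, 1, 0, 1, 2, 3, 2, 3], [2, 1, 0, 1, 2, 3, 2, 3],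
    [1, 2, 3, 0, 1, 0, 1, 2, 3], [3, 2, 3, 0, 1, 0, 1, 2, 3], [0, 1, 2, 3, 1, 0, 1, 2, 3], [3,
    1, 2, 3, 1, 0, 1, 2, 3], [2, 3, 2, 3, 1, 0, 1, 2, 3], [1, 0, 1, 2, 3, 0, 1, 2, 3], [3, 0, 1,
    2, 3, 0, 1, 2, 3], [2, 3, 1, 2, 3, 0, 1, 2, 3], [2, 0, 1, 0, 1, 2, 3, 2, 3], [3, 2, 1, 0, 1,
    2, 3, 2, 3], [0, 1, 2, 3, 0, 1, 0, 1, 2, 3], [3, 1, 2, 3, 0, 1, 0, 1, 2, 3], [2, 3, 2, 3, 0,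
    1, 0, 1, 2, 3], [1, 0, 1, 2, 3, 1, 0, 1, 2, 3], [3, 0, 1, 2, 3, 1, 0, 1, 2, 3], [2, 3, 1, 2,
    3, 1, 0, 1, 2, 3], [1, 2, 3, 2, 3, 1, 0, 1, 2, 3], [0, 1, 0, 1, 2, 3, 0, 1, 2, 3], [3, 2, 3,
    1, 2, 3, 0, 1, 2, 3], [3, 2, 0, 1, 0, 1, 2, 3, 2, 3], [3, 0, 1, 2, 3, 0, 1, 0, 1, 2, 3], [1,
    2, 3, 2, 3, 0, 1, 0, 1, 2, 3], [3, 1, 0, 1, 2, 3, 1, 0, 1, 2, 3], [2, 3, 0, 1, 2, 3, 1, 0,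
    1, 2, 3], [1, 2, 3, 1, 2, 3, 1, 0, 1, 2, 3], [0, 1, 2, 3, 2, 3, 1, 0, 1, 2, 3], [0, 1, 2, 3,
    2, 3, 0, 1, 0, 1, 2, 3], [3, 2, 3, 0, 1, 2, 3, 1, 0, 1, 2, 3]]

/-- Deductions completing the table of the 57 cosets of `⟨a, b, c⟩` in `G`. -/
def facetSteps : List (ℕ × ℕ × ℕ) :=
  [(3, 0, 28), (4, 0, 1), (4, 0, 6), (4, 0, 13), (4, 0, 26), (4, 0, 32), (4, 0, 38),
    (4, 0, 40), (3, 0, 2), (3, 0, 10), (3, 0, 18), (3, 0, 44), (4, 0, 4), (4, 0, 24),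
    (3, 0, 7), (3, 0, 33), (5, 0, 1), (5, 0, 4), (5, 0, 9), (5, 0, 20), (5, 0, 24),
    (5, 0, 30), (5, 0, 43), (1, 1, 3), (1, 1, 11), (1, 1, 19), (1, 1, 45), (3, 1, 5),
    (3, 1, 25), (0, 1, 12), (0, 1, 17), (0, 1, 27), (1, 1, 29), (3, 1, 39), (2, 1, 7),
    (5, 1, 11), (4, 1, 16), (5, 1, 21), (4, 1, 27), (6, 2, 8), (6, 2, 34), (6, 1, 37),
    (5, 0, 48), (2, 1, 33), (5, 1, 45), (4, 1, 54), (7, 2, 10), (7, 2, 44), (4, 0, 15),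
    (4, 0, 53), (3, 1, 16), (3, 1, 54), (1, 0, 28), (5, 0, 38), (0, 1, 35), (0, 0, 36),
    (0, 0, 47), (3, 1, 35), (5, 1, 34), (2, 0, 47), (2, 0, 51), (1, 1, 38), (3, 1, 48),
    (6, 1, 52), (6, 1, 55)]

/-- The subgroup of `G` generated by the generators with the given indices. -/
def parabolic (A : List (Fin 4)) : Subgroup G :=
  Subgroup.closure (PresentedGroup.of '' {x | x ∈ A})

theorem parabolic_mono {A B : List (Fin 4)} (h : A ⊆ B) : parabolic A ≤ parabolic B :=
  Subgroup.closure_mono (Set.image_mono h)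

theorem parabolic_nil : parabolic [] = ⊥ := by
  simp [parabolic]

theorem parabolic_univ : parabolic [0, 1, 2, 3] = ⊤ := by
  rw [← PresentedGroup.closure_range_of rels, parabolic, ← Set.image_univ]
  congr 2
  ext x
  fin_cases x <;> simp

theorem relIndex_parabolic_mem {A B : List (Fin 4)} (reps : List (List (Fin 4)))
    (steps : List (ℕ × ℕ × ℕ))
    (h : ((CosetTable.initial A reps).run relatorWords reps steps).Closed B reps) :
    (parabolic A).relIndex (parabolic B) ∈ Set.Icc 1 reps.length :=
  relIndex_closure_le_of_closed of_mul_self wordProd_relatorWords h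

/-- The facet stabilizer `⟨a, b, c⟩` is finite of order at most 60. -/
theorem card_facetStabilizer_mem : Nat.card (parabolic [0, 1, 2]) ∈ Set.Icc 1 60 := by
  have h₁ := relIndex_parabolic_mem (A := []) (B := [0]) [[], [0]] []
    (by decide +kernel)
  have h₂ := relIndex_parabolic_mem (A := [0]) (B := [0, 1])
    [[], [1], [0, 1], [1, 0, 1], [0, 1, 0, 1]] [(0, 1, 4)] (by decide +kernel)
  have h₃ := relIndex_parabolic_mem (A := [0, 1]) (B := [0, 1, 2])
    [[], [2], [1, 2], [0, 1, 2], [1, 0, 1, 2], [0, 1, 0, 1, 2]]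
    [(3, 0, 1), (1, 1, 2), (3, 1, 3), (0, 1, 5), (6, 2, 4)] (by decide +kernel)
  rw [← Subgroup.relIndex_bot_left, ← parabolic_nil,
    ← Subgroup.relIndex_mul_relIndex _ (parabolic [0, 1]) _ (parabolic_mono (by simp))
      (parabolic_mono (by simp)),
    ← Subgroup.relIndex_mul_relIndex _ (parabolic [0]) _ (parabolic_mono (by simp))
      (parabolic_mono (by simp))]
  exact ⟨Nat.mul_pos (Nat.mul_pos h₁.1 h₂.1) h₃.1,
    Nat.mul_le_mul (Nat.mul_le_mul h₁.2 h₂.2) h₃.2⟩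

theorem index_facetStabilizer_mem : (parabolic [0, 1, 2]).index ∈ Set.Icc 1 57 := by
  rw [← Subgroup.relIndex_top_right, ← parabolic_univ]
  exact relIndex_parabolic_mem facetReps facetSteps (by decide +kernel)

/-! ### The surjection from `G` onto `PSL(2, 19)` -/

open Matrix MatrixGroups SpecialLinearGroup

instance : Fact (Nat.Prime 19) := ⟨by norm_num⟩

/-- Lifts to `SL(2, 19)` of the images of the generators of `G`. -/
def liftGen : Fin 4 → SL(2, ZMod 19) :=
  ![⟨!![0, 1; -1, 0], by decide⟩, ⟨!![2, 2; 7, -2], by decide⟩, ⟨!![1, 6; 6, -1], by decide⟩,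
    ⟨!![8, 7; 7, -8], by decide⟩]

theorem mk_eq_one_of_eq_or_eq_neg {A : SL(2, ZMod 19)} (h : A = 1 ∨ A = -1) :
    (QuotientGroup.mk' (Subgroup.center SL(2, ZMod 19))) A = 1 := by
  rw [QuotientGroup.mk'_apply, QuotientGroup.eq_one_iff, Subgroup.mem_center_iff]
  rcases h with rfl | rfl <;> simp

theorem lift_mk_liftGen_eq_one :
    ∀ r ∈ rels, FreeGroup.lift (fun x => QuotientGroup.mk' (Subgroup.center SL(2, ZMod 19))
      (liftGen x)) r = 1 := by
  have key : ∀ r, FreeGroup.lift (fun x => QuotientGroup.mk' (Subgroup.center SL(2, ZMod 19))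
      (liftGen x)) r = QuotientGroup.mk' _ (FreeGroup.lift liftGen r) := fun r =>
    DFunLike.congr_fun (FreeGroup.ext_hom (f := FreeGroup.lift _)
      (g := (QuotientGroup.mk' _).comp (FreeGroup.lift liftGen)) (by simp)) r
  intro r hr
  rw [key]
  apply mk_eq_one_of_eq_or_eq_neg
  simp only [rels, Set.mem_insert_iff, Set.mem_singleton_iff] at hr
  rcases hr with rfl | rfl | rfl | rfl | rfl | rfl | rfl | rfl | rfl | rfl | rfl | rfl <;>
    simp only [a, b, c, d, map_pow, map_mul, FreeGroup.lift_apply_of] <;> decide +kernel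

/-- The homomorphism from `G` to `PSL(2, 19)` given by `liftGen`. -/
def toPSL : G →* PSL(2, ZMod 19) :=
  PresentedGroup.toGroup lift_mk_liftGen_eq_one

/-- The upper unitriangular matrices in `SL(2, 19)`. -/
abbrev upper (t : ZMod 19) : SL(2, ZMod 19) := SpecialLinearGroup.transvection zero_ne_one t

theorem upper_four_eq : upper 4 = wordProd liftGen [2, 1, 0, 1, 3, 2, 1, 0, 3] ∨
    upper 4 = -1 * wordProd liftGen [2, 1, 0, 1, 3, 2, 1, 0, 3] := by
  decide +kernel

theorem upper_eq_pow (t : ZMod 19) : upper t = upper 4 ^ (5 * t).val := by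
  revert t
  decide +kernel

theorem lower_eq_conj (t : ZMod 19) :
    SpecialLinearGroup.transvection one_ne_zero t = liftGen 0 * upper (-t) * (liftGen 0)⁻¹ := by
  revert t
  decide +kernel

theorem eq_top_of_liftGen_mem {K : Subgroup SL(2, ZMod 19)} (hneg : -1 ∈ K)
    (hgen : ∀ x, liftGen x ∈ K) : K = ⊤ := by
  have hupper : ∀ t, upper t ∈ K := by
    have hword : wordProd liftGen [2, 1, 0, 1, 3, 2, 1, 0, 3] ∈ K :=
      list_prod_mem fun A hA => by
        obtain ⟨x, -, rfl⟩ := List.mem_map.1 hA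
        exact hgen x
    have h4 : upper 4 ∈ K := by
      rcases upper_four_eq with h | h <;> rw [h]
      · exact hword
      · exact mul_mem hneg hword
    intro t
    rw [upper_eq_pow]
    exact pow_mem h4 _
  have hlower : ∀ t : ZMod 19, SpecialLinearGroup.transvection one_ne_zero t ∈ K := by
    intro t
    rw [lower_eq_conj]
    exact mul_mem (mul_mem (hgen 0) (hupper _)) (inv_mem (hgen 0))
  refine (Subgroup.eq_top_iff' K).2 fun A =>
    SL2.transvection_induction (· ∈ K) (fun i j h t => ?_) (fun _ _ => mul_mem) A
  match i, j, h with
  | 0, 0, h => exact absurd rfl h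
  | 0, 1, _ => exact hupper t
  | 1, 0, _ => exact hlower t
  | 1, 1, h => exact absurd rfl h

theorem toPSL_surjective : Function.Surjective toPSL := by
  have htop : toPSL.range.comap (QuotientGroup.mk' (Subgroup.center SL(2, ZMod 19))) = ⊤ := by
    refine eq_top_of_liftGen_mem ?_ fun x =>
      ⟨PresentedGroup.of x, PresentedGroup.toGroup.of lift_mk_liftGen_eq_one⟩
    rw [Subgroup.mem_comap, mk_eq_one_of_eq_or_eq_neg (Or.inr rfl)]
    exact one_mem _
  intro q
  obtain ⟨A, rfl⟩ := QuotientGroup.mk'_surjective _ q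
  exact Subgroup.mem_comap.1 (htop ▸ Subgroup.mem_top A)

/-! ### The order of `PSL(2, 19)` -/

theorem le_card_SL : 6840 ≤ Nat.card SL(2, ZMod 19) := by
  have hker : (GeneralLinearGroup.det : GL (Fin 2) (ZMod 19) →* _).ker =
      (SpecialLinearGroup.toGL : SL(2, ZMod 19) →* _).range := by
    ext A
    refine ⟨fun h => ⟨⟨A, congrArg Units.val h⟩, by ext; rfl⟩, ?_⟩
    rintro ⟨B, rfl⟩
    ext
    exact B.2
  have hcard := Subgroup.card_mul_index (GeneralLinearGroup.det : GL (Fin 2) (ZMod 19) →* _).ker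
  have hdet : (GeneralLinearGroup.det : GL (Fin 2) (ZMod 19) →* _).ker.index ≤ 18 := by
    rw [Subgroup.index_ker]
    refine (Subgroup.card_le_card_group _).trans_eq ?_
    rw [Nat.card_eq_fintype_card, ZMod.card_units]
  rw [card_GL_field, hker, ← Nat.card_congr (MonoidHom.ofInjective toGL_injective).toEquiv,
    ← hker] at hcard
  simp only [Fin.prod_univ_two, ZMod.card, Fin.val_zero, Fin.val_one] at hcard
  norm_num [-Nat.card_eq_fintype_card] at hcard
  nlinarith

theorem le_card_PSL : 3420 ≤ Nat.card PSL(2, ZMod 19) := by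
  have hc : Nat.card (Subgroup.center SL(2, ZMod 19)) ≤ 2 := by
    rw [Nat.card_congr (center_equiv_rootsOfUnity' 0).toEquiv]
    exact card_rootsOfUnity _ _
  have h := Subgroup.card_eq_card_quotient_mul_card_subgroup (Subgroup.center SL(2, ZMod 19))
  have := le_card_SL
  nlinarith

/-- The facet stabilizer `⟨a, b, c⟩` has index 57, and `G` has order 3420. -/
theorem index_facetStabilizer_and_card :
    (parabolic [0, 1, 2]).index = 57 ∧ Nat.card G = 3420 := by
  obtain ⟨hH, hH'⟩ := card_facetStabilizer_mem
  obtain ⟨hi, hi'⟩ := index_facetStabilizer_mem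
  have hcard := Subgroup.card_mul_index (parabolic [0, 1, 2])
  have : Finite G := Nat.finite_of_card_ne_zero (by rw [← hcard]; positivity)
  have hle := le_card_PSL.trans (Nat.card_le_card_of_surjective toPSL toPSL_surjective)
  have h57 : (parabolic [0, 1, 2]).index = 57 := by nlinarith
  have h60 : Nat.card (parabolic [0, 1, 2]) = 60 := by nlinarith
  exact ⟨h57, by rw [← hcard, h57, h60]⟩

/-- The group presented on `a, b, c, d` with relators `a², b², c², d², (ab)⁵, (bc)³,
`(cd)⁵, (ac)², (ad)², (bd)², (abc)⁵` and `(bcd)⁵` (the group of the 57-cell) is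
isomorphic to `PSL(2, 19)`, has order 3420, and its subgroup `⟨a, b, c⟩` has index 57. -/
theorem statement_13 :
    Nonempty (G ≃* Matrix.ProjectiveSpecialLinearGroup (Fin 2) (ZMod 19)) ∧
    Nat.card G = 3420 ∧
    (Subgroup.closure {ga, gb, gc}).index = 57 := by
  obtain ⟨hindex, hcard⟩ := index_facetStabilizer_and_card
  have : Finite G := Nat.finite_of_card_ne_zero (by simp [hcard])
  have hbij : Function.Bijective toPSL :=
    (Nat.bijective_iff_surjective_and_card toPSL).2 ⟨toPSL_surjective, le_antisymm
      (hcard.trans_le le_card_PSL) (Nat.card_le_card_of_surjective toPSL toPSL_surjective)⟩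
  refine ⟨⟨MulEquiv.ofBijective toPSL hbij⟩, hcard, ?_⟩
  rw [← hindex, parabolic]
  congr 2
  ext x
  simp [ga, gb, gc, eq_comm]

end Stmt13
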